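/- arXiv:2106.15588 — 10 statements merged into one kernel-verified Lean document; each statement's English description precedes it below -/
import Mathlib

section
/- Let p₀, p₁, p₂ be positive integers with gcd(p₀, p₁, p₂) = 1, let n = p₀ + p₁ + p₂, and let σ₀, σ₁ be the monodromy permutations of the dessin D(p₀, p₁, p₂) acting on the edge set (ℤ/nℤ) × {0,1,2}. Let G = ⟨σ₀, σ₁⟩, N = ⟨σ₀σ₁, σ₁σ₀⟩, and H = ⟨σ₀⟩. Then G is the internal semidirect product of N and H; that is, N is a normal subgroup of G, N ∩ H = {id}, and NH = G. -/
open scoped Pointwise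

/-- Rotation about the black vertex: `(m, i) ↦ (m, i+1)` on `ZMod n × Fin 3`. -/
def sigma0 (n : ℕ) : Equiv.Perm (ZMod n × Fin 3) :=
  (Equiv.refl (ZMod n)).prodCongr (Equiv.addRight (1 : Fin 3))

/-- The amount subtracted from the first coordinate by `σ₁`, by side index. -/
def shift (p0 p1 p2 n : ℕ) : Fin 3 → ZMod n := ![(p1 : ZMod n), (p2 : ZMod n), (p0 : ZMod n)]

/-- Rotation about the white vertex:
`(m,0) ↦ (m-p₁,2)`, `(m,1) ↦ (m-p₂,0)`, `(m,2) ↦ (m-p₀,1)`. -/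
def sigma1 (p0 p1 p2 n : ℕ) : Equiv.Perm (ZMod n × Fin 3) where
  toFun x := (x.1 - shift p0 p1 p2 n x.2, x.2 + 2)
  invFun x := (x.1 + shift p0 p1 p2 n (x.2 + 1), x.2 + 1)
  left_inv := by
    rintro ⟨m, i⟩
    fin_cases i <;> simp [shift]
  right_inv := by
    rintro ⟨m, i⟩
    fin_cases i <;> simp [shift]

lemma sigma0_apply (n : ℕ) (x : ZMod n × Fin 3) : sigma0 n x = (x.1, x.2 + 1) := rfl

lemma sigma1_apply (p0 p1 p2 n : ℕ) (x : ZMod n × Fin 3) :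
    sigma1 p0 p1 p2 n x = (x.1 - shift p0 p1 p2 n x.2, x.2 + 2) := rfl

/-- The rotation about the black vertices has order dividing three. -/
lemma sigma0_mul_sigma0_mul_sigma0 (n : ℕ) : sigma0 n * sigma0 n * sigma0 n = 1 := by
  ext1 ⟨m, i⟩
  fin_cases i <;> simp [sigma0_apply]

/-- The translations `σ₀σ₁`, `σ₁σ₀` and `σ₀²σ₁σ₀²` compose to the identity, because the three
shifts add up to `n`. -/
lemma sigma_translations_mul (p0 p1 p2 n : ℕ) (hn : n = p0 + p1 + p2) :
    sigma0 n * (sigma0 n * sigma1 p0 p1 p2 n) * sigma0 n * sigma0 n *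
      ((sigma0 n * sigma1 p0 p1 p2 n) * (sigma1 p0 p1 p2 n * sigma0 n)) = 1 := by
  have h : (p0 : ZMod n) + p1 + p2 = 0 := by
    rw [← Nat.cast_add, ← Nat.cast_add, ← hn, ZMod.natCast_self]
  ext1 ⟨m, i⟩
  fin_cases i <;> simp [sigma0_apply, sigma1_apply, shift] <;> linear_combination -h

/-- A subgroup is normalized by an element of order dividing three as soon as conjugation by
that element maps the subgroup into itself. -/
lemma mem_normalizer_of_mul_mul_eq_one {G : Type*} [Group G] {N : Subgroup G} {s : G}
    (hs : s * s * s = 1) (h : ∀ x ∈ N, s * x * s⁻¹ ∈ N) :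
    s ∈ Subgroup.normalizer (N : Set G) := by
  refine Subgroup.mem_normalizer_iff.2 fun x ↦ ⟨h x, fun hx ↦ ?_⟩
  have key : s * (s * (s * x * s⁻¹) * s⁻¹) * s⁻¹ = (s * s * s) * x * (s * s * s)⁻¹ := by group
  have := h _ (h _ hx)
  rwa [key, hs, one_mul, inv_one, mul_one] at this

/-- Conjugation by `s` maps `⟨st, ts⟩` into itself when `s³ = 1` and the three conjugates of `st`
under `s` have trivial product. -/
lemma conj_mem_closure_pair {G : Type*} [Group G] {s t : G} (hs : s * s * s = 1)
    (h : s * (s * t) * s * s * ((s * t) * (t * s)) = 1) :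
    ∀ x ∈ Subgroup.closure {s * t, t * s},
      s * x * s⁻¹ ∈ Subgroup.closure {s * t, t * s} := by
  have ha : s * t ∈ Subgroup.closure {s * t, t * s} := Subgroup.subset_closure (by simp)
  have hb : t * s ∈ Subgroup.closure {s * t, t * s} := Subgroup.subset_closure (by simp)
  have hinv : s⁻¹ = s * s := inv_eq_of_mul_eq_one_left hs
  intro x hx
  induction hx using Subgroup.closure_induction with
  | mem x hx =>
    rcases hx with rfl | rfl
    · have : s * (s * t) * s⁻¹ = ((s * t) * (t * s))⁻¹ := by
        rw [hinv, ← mul_assoc]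
        exact eq_inv_of_mul_eq_one_left h
      rw [this]
      exact inv_mem (mul_mem ha hb)
    · simpa [mul_assoc] using ha
  | one => simp
  | mul x y _ _ hx hy => simpa [mul_assoc] using mul_mem hx hy
  | inv x _ hx => simpa [mul_assoc] using inv_mem hx

/-- A subgroup generated by permutations that preserve a function preserves that function. -/
lemma comp_eq_of_mem_closure {α β : Type*} (f : α → β) {S : Set (Equiv.Perm α)}
    (hS : ∀ g ∈ S, ∀ x, f (g x) = f x) {g : Equiv.Perm α} (hg : g ∈ Subgroup.closure S) (x : α) :
    f (g x) = f x := by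
  induction hg using Subgroup.closure_induction generalizing x with
  | mem g hg => exact hS g hg x
  | one => rfl
  | mul g h _ _ ihg ihh => rw [Equiv.Perm.mul_apply, ihg, ihh]
  | inv g _ ih => simpa using (ih (g⁻¹ x)).symm

theorem stmt_0 (p0 p1 p2 : ℕ) (hp0 : 0 < p0) (hp1 : 0 < p1) (hp2 : 0 < p2) (hgcd : Nat.gcd p0 (Nat.gcd p1 p2) = 1)
    (n : ℕ) (hn : n = p0 + p1 + p2)
    (σ0 σ1 : Equiv.Perm (ZMod n × Fin 3))
    (hσ0 : σ0 = sigma0 n) (hσ1 : σ1 = sigma1 p0 p1 p2 n)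
    (G N H : Subgroup (Equiv.Perm (ZMod n × Fin 3)))
    (hG : G = Subgroup.closure {σ0, σ1})
    (hN : N = Subgroup.closure {σ0 * σ1, σ1 * σ0})
    (hH : H = Subgroup.closure {σ0}) :
    N ≤ G ∧ H ≤ G ∧ (∀ g ∈ G, ∀ x ∈ N, g * x * g⁻¹ ∈ N) ∧ N ⊓ H = ⊥ ∧
      (N : Set (Equiv.Perm (ZMod n × Fin 3))) * (H : Set (Equiv.Perm (ZMod n × Fin 3))) =
        (G : Set (Equiv.Perm (ZMod n × Fin 3))) := by
  subst hσ0 hσ1 hG hN hH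
  have hs := sigma0_mul_sigma0_mul_sigma0 n
  have hprod := sigma_translations_mul p0 p1 p2 n hn
  generalize hN : Subgroup.closure {sigma0 n * sigma1 p0 p1 p2 n, sigma1 p0 p1 p2 n * sigma0 n} = N
  generalize hH : Subgroup.closure {sigma0 n} = H
  generalize hG : Subgroup.closure {sigma0 n, sigma1 p0 p1 p2 n} = G
  have h0G : sigma0 n ∈ G := hG ▸ Subgroup.subset_closure (by simp)
  have h1G : sigma1 p0 p1 p2 n ∈ G := hG ▸ Subgroup.subset_closure (by simp)
  have h0H : sigma0 n ∈ H := hH ▸ Subgroup.subset_closure (by simp)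
  have haN : sigma0 n * sigma1 p0 p1 p2 n ∈ N := hN ▸ Subgroup.subset_closure (by simp)
  have h0 : sigma0 n ∈ Subgroup.normalizer (N : Set (Equiv.Perm (ZMod n × Fin 3))) :=
    mem_normalizer_of_mul_mul_eq_one hs (hN ▸ conj_mem_closure_pair hs hprod)
  have h1 : sigma1 p0 p1 p2 n ∈ Subgroup.normalizer (N : Set (Equiv.Perm (ZMod n × Fin 3))) :=
    (Subgroup.mul_mem_cancel_left _ h0).1 (Subgroup.le_normalizer haN)
  have hNG : N ≤ G := by
    rw [← hN, Subgroup.closure_le]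
    rintro _ (rfl | rfl)
    exacts [mul_mem h0G h1G, mul_mem h1G h0G]
  have hHG : H ≤ G := by
    rw [← hH, Subgroup.closure_le]
    rintro _ rfl
    exact h0G
  have hGnorm : G ≤ Subgroup.normalizer (N : Set (Equiv.Perm (ZMod n × Fin 3))) := by
    rw [← hG, Subgroup.closure_le]
    rintro _ (rfl | rfl)
    exacts [h0, h1]
  refine ⟨hNG, hHG, fun g hg x hx ↦ (Subgroup.mem_normalizer_iff.1 (hGnorm hg) x).1 hx, ?_, ?_⟩
  · rw [eq_bot_iff]
    rintro g ⟨hgN, hgH⟩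
    rw [← hN] at hgN
    rw [← hH] at hgH
    refine Subgroup.mem_bot.2 (Equiv.ext fun x ↦ Prod.ext ?_ ?_)
    · refine comp_eq_of_mem_closure Prod.fst ?_ hgH x
      rintro _ rfl y
      rfl
    · refine comp_eq_of_mem_closure Prod.snd ?_ hgN x
      rintro _ (rfl | rfl) ⟨m, i⟩ <;> fin_cases i <;> simp [sigma0_apply, sigma1_apply]
  · rw [← Subgroup.coe_mul_of_right_le_normalizer_left N H (hHG.trans hGnorm)]
    congr 1
    refine le_antisymm (sup_le hNG hHG) ?_
    have h0S : sigma0 n ∈ N ⊔ H := Subgroup.mem_sup_right h0H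
    rw [← hG, Subgroup.closure_le]
    rintro _ (rfl | rfl)
    exacts [h0S, (Subgroup.mul_mem_cancel_left _ h0S).1 (Subgroup.mem_sup_left haN)]
end

section
/- Let p₀, p₁, p₂ be positive integers with gcd(p₀, p₁, p₂) = 1, let n = p₀ + p₁ + p₂, let σ₀, σ₁ be the monodromy permutations of the dessin D(p₀, p₁, p₂), and let G = ⟨σ₀, σ₁⟩. Set α = gcd(n, p₀p₁ − p₂²) (computed as a gcd of integers, with p₀p₁ − p₂² taken as an integer). Then there exists an action φ of the cyclic group C₃ on the abelian group Cₙ × C_{n/α} (i.e., a group homomorphism φ : C₃ → Aut(Cₙ × C_{n/α})) such that G is isomorphic to the semidirect product (Cₙ × C_{n/α}) ⋊_φ C₃, where Cₖ denotes the cyclic group ℤ/kℤ. -/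
/-- An internal semidirect product of the images of two injective homomorphisms is an external
semidirect product of their domains. -/
theorem exists_sup_range_mulEquiv_semidirectProduct {Γ B C : Type*} [Group Γ] [Group B] [Group C]
    {f : B →* Γ} {g : C →* Γ} (hf : Function.Injective f) (hg : Function.Injective g)
    (hdisj : Disjoint f.range g.range)
    (hnorm : g.range ≤ Subgroup.normalizer (f.range : Set Γ)) :
    ∃ φ : C →* MulAut B, Nonempty (↥(f.range ⊔ g.range) ≃* B ⋊[φ] C) := by
  have hle₁ : f.range ≤ f.range ⊔ g.range := le_sup_left
  have hle₂ : g.range ≤ f.range ⊔ g.range := le_sup_right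
  have : (f.range.subgroupOf (f.range ⊔ g.range)).Normal :=
    (Subgroup.normal_subgroupOf_iff_le_normalizer hle₁).2 (sup_le Subgroup.le_normalizer hnorm)
  have hcompl : (f.range.subgroupOf (f.range ⊔ g.range)).IsComplement'
      (g.range.subgroupOf (f.range ⊔ g.range)) := by
    apply Subgroup.isComplement'_of_disjoint_and_mul_eq_univ
    · rw [disjoint_iff, eq_bot_iff]
      rintro ⟨x, hx⟩ ⟨h₁, h₂⟩
      exact Subtype.ext (Subgroup.disjoint_def.1 hdisj h₁ h₂)
    · rw [← Subgroup.normal_mul, ← Subgroup.subgroupOf_sup hle₁ hle₂, Subgroup.subgroupOf_self]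
      rfl
  exact ⟨_, ⟨(SemidirectProduct.mulEquivSubgroup hcompl).symm.trans (SemidirectProduct.congr'
    ((Subgroup.subgroupOfEquivOfLe hle₁).trans (MonoidHom.ofInjective hf).symm)
    ((Subgroup.subgroupOfEquivOfLe hle₂).trans (MonoidHom.ofInjective hg).symm))⟩⟩

/-- The multiples of an integer `d` in `ℤ/nℤ` form a copy of `ℤ/(n / gcd(n, d))ℤ`. -/
theorem ZMod.exists_injective_addMonoidHom_range_multiples {n : ℕ} (hn : 0 < n) (d : ℤ) :
    ∃ L : ZMod (n / Int.gcd n d) →+ ZMod n, Function.Injective L ∧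
      ∀ y, (∃ s, L s = y) ↔ ∃ z, y = z * (d : ZMod n) := by
  have hα : 0 < Int.gcd n d := Int.gcd_pos_of_ne_zero_left _ (by omega)
  obtain ⟨m, hm⟩ : Int.gcd n d ∣ n := Int.natCast_dvd_natCast.1 (Int.gcd_dvd_left _ _)
  have hdiv : n / Int.gcd n d = m := by
    conv_lhs => rw [hm]
    simp only [← hm]
    exact Nat.div_eq_of_eq_mul_right hα hm
  have key : ∀ k : ℤ, ((k * d : ℤ) : ZMod n) = 0 ↔ (m : ℤ) ∣ k := by
    intro k
    rw [ZMod.intCast_zmod_eq_zero_iff_dvd]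
    obtain ⟨e, he⟩ := Int.gcd_dvd_right (n : ℤ) d
    have hm' : (n : ℤ) = (Int.gcd n d : ℤ) * m := by exact_mod_cast hm
    have hcop : Int.gcd m e = 1 := by
      have := Int.gcd_div_gcd_div_gcd hα
      rwa [Int.ediv_eq_of_eq_mul_right (by omega) hm',
        Int.ediv_eq_of_eq_mul_right (by omega) he] at this
    generalize Int.gcd n d = α at *
    have hα' : (α : ℤ) ≠ 0 := by omega
    rw [he, hm', show k * (α * e) = α * (e * k) by ring, mul_dvd_mul_iff_left hα']
    exact ⟨fun h => Int.dvd_of_dvd_mul_right_of_gcd_one h hcop, fun h => h.mul_left _⟩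
  rw [hdiv]
  refine ⟨ZMod.lift m ⟨zmultiplesHom _ (d : ZMod n), ?_⟩, ?_, ?_⟩
  · simpa using (key m).2 dvd_rfl
  · rw [ZMod.lift_injective]
    intro k hk
    rw [ZMod.intCast_zmod_eq_zero_iff_dvd, ← key]
    simpa using hk
  · intro y
    constructor
    · rintro ⟨s, rfl⟩
      obtain ⟨k, rfl⟩ := ZMod.intCast_surjective s
      exact ⟨k, by simp⟩
    · rintro ⟨z, rfl⟩
      obtain ⟨k, rfl⟩ := ZMod.intCast_surjective z
      exact ⟨k, by simp⟩

/-- The permutations `(m, i) ↦ (m + a i, i)`. -/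
def fiberTranslation (R ι : Type*) [AddCommGroup R] :
    Multiplicative (ι → R) →* Equiv.Perm (R × ι) where
  toFun a :=
    { toFun x := (x.1 + a.toAdd x.2, x.2)
      invFun x := (x.1 - a.toAdd x.2, x.2)
      left_inv x := by simp
      right_inv x := by simp }
  map_one' := by ext <;> simp
  map_mul' a b := by ext <;> simp [add_comm, add_left_comm]

/-- The permutations `(m, i) ↦ (m, i + k)`. -/
def baseTranslation (R ι : Type*) [AddCommGroup ι] :
    Multiplicative ι →* Equiv.Perm (R × ι) where
  toFun k := (Equiv.refl R).prodCongr (Equiv.addRight k.toAdd)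
  map_one' := by ext <;> simp
  map_mul' a b := by ext <;> simp [add_comm, add_left_comm]

section Translations

variable {R ι : Type*}

@[simp]
theorem fiberTranslation_apply [AddCommGroup R] (a : Multiplicative (ι → R)) (x : R × ι) :
    fiberTranslation R ι a x = (x.1 + a.toAdd x.2, x.2) := rfl

@[simp]
theorem baseTranslation_apply [AddCommGroup ι] (k : Multiplicative ι) (x : R × ι) :
    baseTranslation R ι k x = (x.1, x.2 + k.toAdd) := rfl

variable [AddCommGroup R]

theorem fiberTranslation_injective : Function.Injective (fiberTranslation R ι) := by
  intro a b h
  refine Multiplicative.toAdd.injective (funext fun i => ?_)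
  simpa using congrArg Prod.fst (Equiv.congr_fun h (0, i))

theorem baseTranslation_injective [AddCommGroup ι] :
    Function.Injective (baseTranslation R ι) := by
  intro a b h
  simpa using congrArg Prod.snd (Equiv.congr_fun h (0, 0))

theorem disjoint_range_fiberTranslation_baseTranslation [AddCommGroup ι] :
    Disjoint (fiberTranslation R ι).range (baseTranslation R ι).range := by
  rw [Subgroup.disjoint_def]
  rintro _ ⟨a, rfl⟩ ⟨k, hk⟩
  have hk' : k = 1 := by simpa using congrArg Prod.snd (Equiv.congr_fun hk (0, 0))
  rw [← hk, hk', map_one]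

theorem baseTranslation_conj_fiberTranslation [AddCommGroup ι] (k : Multiplicative ι)
    (a : Multiplicative (ι → R)) :
    baseTranslation R ι k * fiberTranslation R ι a * (baseTranslation R ι k)⁻¹ =
      fiberTranslation R ι (Multiplicative.ofAdd fun i => a.toAdd (i - k.toAdd)) := by
  rw [mul_inv_eq_iff_eq_mul]
  ext x <;> simp

end Translations

/-- The vectors in the span of `(a, b, c)` and `(b, c, a)` over `ℤ/nℤ`, where `a + b + c = 0` and
`a, b` generate the unit ideal, form a copy of `ℤ/nℤ × ℤ/(n / gcd(n, ac - b²))ℤ`. -/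
theorem exists_injective_addMonoidHom_range_span {n : ℕ} (hn : 0 < n) {a b c x y : ZMod n}
    (hsum : a + b + c = 0) (hxy : x * a + y * b = 1) (d : ℤ)
    (hd : (d : ZMod n) = a * c - b ^ 2) :
    ∃ P : ZMod n × ZMod (n / Int.gcd n d) →+ (Fin 3 → ZMod n), Function.Injective P ∧
      ∀ v, (∃ z, P z = v) ↔ ∃ r s : ZMod n, v = r • ![a, b, c] + s • ![b, c, a] := by
  obtain ⟨L, hL, hLr⟩ := ZMod.exists_injective_addMonoidHom_range_multiples hn d
  obtain rfl : c = -a - b := by linear_combination hsum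
  refine ⟨{
    toFun z := z.1 • ![1, x * b + y * (-a - b), -1 - (x * b + y * (-a - b))] + L z.2 • ![0, 1, -1]
    map_zero' := by simp
    map_add' z w := by simp only [Prod.fst_add, Prod.snd_add, map_add]; module }, ?_, ?_⟩
  · rw [injective_iff_map_eq_zero]
    rintro ⟨r, s⟩ h
    have h0 : r = 0 := by simpa using congrFun h 0
    have h1 : L s = 0 := by simpa [h0] using congrFun h 1
    rw [h0, (injective_iff_map_eq_zero L).1 hL s h1]
    rfl
  · intro v
    constructor
    · rintro ⟨⟨r, s⟩, rfl⟩
      obtain ⟨z, hz⟩ := (hLr _).1 ⟨s, rfl⟩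
      refine ⟨r * x - z * b, r * y + z * a, ?_⟩
      ext i
      fin_cases i <;> simp [hz, hd]
      · linear_combination (-r) * hxy
      · ring
      · linear_combination r * hxy
    · rintro ⟨r, s, rfl⟩
      obtain ⟨z, hz⟩ := (hLr _).2 ⟨s * x - r * y, rfl⟩
      refine ⟨(r * a + s * b, z), ?_⟩
      ext i
      fin_cases i <;> simp [hz, hd]
      · linear_combination (r * b - s * (a + b)) * hxy
      · linear_combination (-(r * b - s * (a + b))) * hxy

theorem sigma0_eq (n : ℕ) :
    sigma0 n = baseTranslation (ZMod n) (Fin 3) (Multiplicative.ofAdd 1) := rfl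

theorem sigma1_eq (p0 p1 p2 n : ℕ) :
    sigma1 p0 p1 p2 n = baseTranslation (ZMod n) (Fin 3) (Multiplicative.ofAdd 2) *
      (fiberTranslation (ZMod n) (Fin 3) (Multiplicative.ofAdd (shift p0 p1 p2 n)))⁻¹ :=
  Equiv.ext fun _ => rfl

section CyclicShifts

variable {n : ℕ} {a b c : ZMod n} {N : Subgroup (Equiv.Perm (ZMod n × Fin 3))}

theorem baseTranslation_conj_mem_of_mem_iff (hsum : a + b + c = 0)
    (hN : ∀ g, g ∈ N ↔ ∃ r s : ZMod n, fiberTranslation (ZMod n) (Fin 3)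
      (Multiplicative.ofAdd (r • ![a, b, c] + s • ![b, c, a])) = g)
    (k : Multiplicative (Fin 3)) {g : Equiv.Perm (ZMod n × Fin 3)} (hg : g ∈ N) :
    baseTranslation (ZMod n) (Fin 3) k * g * (baseTranslation (ZMod n) (Fin 3) k)⁻¹ ∈ N := by
  obtain ⟨r, s, rfl⟩ := (hN g).1 hg
  rw [baseTranslation_conj_fiberTranslation, hN]
  obtain rfl : c = -a - b := by linear_combination hsum
  obtain ⟨k, rfl⟩ := Multiplicative.ofAdd.surjective k
  suffices ∃ r' s' : ZMod n, r' • ![a, b, -a - b] + s' • ![b, -a - b, a] =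
      fun i => (r • ![a, b, -a - b] + s • ![b, -a - b, a]) (i - k) by
    obtain ⟨r', s', h⟩ := this
    exact ⟨r', s', congrArg _ (congrArg _ h)⟩
  fin_cases k
  · exact ⟨r, s, by ext i; simp⟩
  · refine ⟨s - r, -r, ?_⟩
    ext i
    fin_cases i <;> simp [show (-1 : Fin 3) = 2 by decide, show (2 - 1 : Fin 3) = 1 by decide] <;>
      ring
  · refine ⟨-s, r - s, ?_⟩
    ext i
    fin_cases i <;> simp [show (-2 : Fin 3) = 1 by decide, show (1 - 2 : Fin 3) = 2 by decide] <;>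
      ring

theorem range_baseTranslation_le_normalizer (hsum : a + b + c = 0)
    (hN : ∀ g, g ∈ N ↔ ∃ r s : ZMod n, fiberTranslation (ZMod n) (Fin 3)
      (Multiplicative.ofAdd (r • ![a, b, c] + s • ![b, c, a])) = g) :
    (baseTranslation (ZMod n) (Fin 3)).range ≤
      Subgroup.normalizer (N : Set (Equiv.Perm (ZMod n × Fin 3))) := by
  rintro _ ⟨k, rfl⟩
  refine Subgroup.mem_normalizer_iff.2 fun g =>
    ⟨baseTranslation_conj_mem_of_mem_iff hsum hN k, fun h => ?_⟩
  have := baseTranslation_conj_mem_of_mem_iff hsum hN k⁻¹ h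
  rw [map_inv] at this
  simpa [mul_assoc] using this

theorem closure_sigma_eq_sup {p0 p1 p2 : ℕ}
    (hN : ∀ g, g ∈ N ↔ ∃ r s : ZMod n, fiberTranslation (ZMod n) (Fin 3) (Multiplicative.ofAdd
      (r • ![(p1 : ZMod n), p2, p0] + s • ![(p2 : ZMod n), p0, p1])) = g) :
    Subgroup.closure {sigma0 n, sigma1 p0 p1 p2 n} =
      N ⊔ (baseTranslation (ZMod n) (Fin 3)).range := by
  apply le_antisymm
  · rw [Subgroup.closure_le]
    rintro g (rfl | rfl)
    · exact Subgroup.mem_sup_right ⟨_, rfl⟩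
    · rw [sigma1_eq]
      refine mul_mem (Subgroup.mem_sup_right ⟨_, rfl⟩) (inv_mem (Subgroup.mem_sup_left ?_))
      exact (hN _).2 ⟨1, 0, by simp [shift]⟩
  · set G := Subgroup.closure {sigma0 n, sigma1 p0 p1 p2 n}
    have h₀ : sigma0 n ∈ G := Subgroup.subset_closure (by simp)
    have h₁ : sigma1 p0 p1 p2 n ∈ G := Subgroup.subset_closure (by simp)
    have hB : ∀ k, baseTranslation (ZMod n) (Fin 3) k ∈ G := by
      intro k
      obtain ⟨j, rfl⟩ : ∃ j : ℕ, k = Multiplicative.ofAdd 1 ^ j := by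
        obtain ⟨k, rfl⟩ := Multiplicative.ofAdd.surjective k
        exact ⟨k.val, by fin_cases k <;> rfl⟩
      rw [map_pow, ← sigma0_eq]
      exact pow_mem h₀ j
    have hv : fiberTranslation (ZMod n) (Fin 3)
        (Multiplicative.ofAdd ![(p1 : ZMod n), p2, p0]) ∈ G := by
      rw [sigma1_eq, Subgroup.mul_mem_cancel_left _ (hB _), inv_mem_iff] at h₁
      exact h₁
    have hw : fiberTranslation (ZMod n) (Fin 3)
        (Multiplicative.ofAdd ![(p2 : ZMod n), p0, p1]) ∈ G := by
      have := mul_mem (mul_mem (hB (Multiplicative.ofAdd 2)) hv)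
        (inv_mem (hB (Multiplicative.ofAdd 2)))
      rw [baseTranslation_conj_fiberTranslation] at this
      convert this using 3
      ext i
      fin_cases i <;> rfl
    have hsmul : ∀ (r : ZMod n) (v : Fin 3 → ZMod n),
        fiberTranslation (ZMod n) (Fin 3) (Multiplicative.ofAdd v) ∈ G →
        fiberTranslation (ZMod n) (Fin 3) (Multiplicative.ofAdd (r • v)) ∈ G := by
      intro r v h
      obtain ⟨k, rfl⟩ := ZMod.intCast_surjective r
      rw [Int.cast_smul_eq_zsmul, ofAdd_zsmul, map_zpow]
      exact zpow_mem h k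
    refine sup_le (fun g hg => ?_) ?_
    · obtain ⟨r, s, rfl⟩ := (hN g).1 hg
      rw [ofAdd_add, map_mul]
      exact mul_mem (hsmul r _ hv) (hsmul s _ hw)
    · rintro _ ⟨k, rfl⟩
      exact hB k

end CyclicShifts

theorem stmt_1 (p0 p1 p2 : ℕ) (hp0 : 0 < p0) (hp1 : 0 < p1) (hp2 : 0 < p2) (hgcd : Nat.gcd p0 (Nat.gcd p1 p2) = 1)
    (n : ℕ) (hn : n = p0 + p1 + p2)
    (σ0 σ1 : Equiv.Perm (ZMod n × Fin 3))
    (hσ0 : σ0 = sigma0 n) (hσ1 : σ1 = sigma1 p0 p1 p2 n)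
    (G : Subgroup (Equiv.Perm (ZMod n × Fin 3)))
    (hG : G = Subgroup.closure {σ0, σ1})
    (α : ℕ) (hα : α = Int.gcd (n : ℤ) ((p0 : ℤ) * p1 - (p2 : ℤ) ^ 2)) :
    ∃ φ : Multiplicative (ZMod 3) →*
        MulAut (Multiplicative (ZMod n) × Multiplicative (ZMod (n / α))),
      Nonempty (G ≃*
        SemidirectProduct (Multiplicative (ZMod n) × Multiplicative (ZMod (n / α)))
          (Multiplicative (ZMod 3)) φ) := by
  subst hσ0 hσ1 hG hα
  have hn0 : 0 < n := by omega
  have hsum : (p1 : ZMod n) + p2 + p0 = 0 := by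
    rw [← ZMod.natCast_self n, hn]
    push_cast
    ring
  obtain ⟨x, y, hxy⟩ : ∃ x y : ZMod n, x * (p1 : ZMod n) + y * p2 = 1 := by
    have h₁ := Nat.gcd_eq_gcd_ab p0 (Nat.gcd p1 p2)
    rw [hgcd, Nat.gcd_eq_gcd_ab p1 p2] at h₁
    generalize Nat.gcdA p0 _ = u, Nat.gcdB p0 _ = v, Nat.gcdA p1 _ = u', Nat.gcdB p1 _ = v' at h₁
    have h₂ := congrArg (Int.cast : ℤ → ZMod n) h₁
    push_cast at h₂
    exact ⟨u' * v - u, v' * v - u, by linear_combination -h₂ - u * hsum⟩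
  obtain ⟨P, hP, hPr⟩ := exists_injective_addMonoidHom_range_span hn0 hsum hxy
    ((p0 : ℤ) * p1 - (p2 : ℤ) ^ 2) (by push_cast; ring)
  let f := ((fiberTranslation (ZMod n) (Fin 3)).comp P.toMultiplicative).comp
    (MulEquiv.prodMultiplicative (ZMod n) _).symm.toMonoidHom
  let g := (baseTranslation (ZMod n) (Fin 3)).comp
    (ZMod.finEquiv 3).symm.toAddEquiv.toMultiplicative.toMonoidHom
  have hf : Function.Injective f :=
    (fiberTranslation_injective.comp hP).comp
      (MulEquiv.prodMultiplicative (ZMod n) _).symm.injective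
  have hg : Function.Injective g := baseTranslation_injective.comp
    (ZMod.finEquiv 3).symm.toAddEquiv.toMultiplicative.injective
  have hfr : f.range ≤ (fiberTranslation (ZMod n) (Fin 3)).range := by
    rintro _ ⟨z, rfl⟩
    exact ⟨_, rfl⟩
  have hgr : g.range = (baseTranslation (ZMod n) (Fin 3)).range :=
    SetLike.coe_injective
      ((ZMod.finEquiv 3).symm.toAddEquiv.toMultiplicative.surjective.range_comp _)
  have hN : ∀ h, h ∈ f.range ↔ ∃ r s : ZMod n, fiberTranslation (ZMod n) (Fin 3)
      (Multiplicative.ofAdd (r • ![(p1 : ZMod n), p2, p0] + s • ![(p2 : ZMod n), p0, p1])) = h := by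
    intro h
    constructor
    · rintro ⟨z, rfl⟩
      obtain ⟨r, s, hz⟩ := (hPr _).1 ⟨(z.1.toAdd, z.2.toAdd), rfl⟩
      exact ⟨r, s, by rw [← hz]; rfl⟩
    · rintro ⟨r, s, rfl⟩
      obtain ⟨z, hz⟩ := (hPr _).2 ⟨r, s, rfl⟩
      exact ⟨(Multiplicative.ofAdd z.1, Multiplicative.ofAdd z.2), by rw [← hz]; rfl⟩
  rw [closure_sigma_eq_sup hN, ← hgr]
  refine exists_sup_range_mulEquiv_semidirectProduct hf hg ?_ ?_
  · rw [hgr]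
    exact disjoint_range_fiberTranslation_baseTranslation.mono_left hfr
  · rw [hgr]
    exact range_baseTranslation_le_normalizer hsum hN
end

section
/- Let p₀, p₁, p₂ be positive integers with gcd(p₀, p₁, p₂) = 1, let n = p₀ + p₁ + p₂, and let σ₀, σ₁ be the monodromy permutations of the dessin D(p₀, p₁, p₂). Set α = gcd(n, p₀p₁ − p₂²) (a gcd of integers, with p₀p₁ − p₂² taken as an integer). Then the subgroup N = ⟨σ₀σ₁, σ₁σ₀⟩ of the permutation group of the edge set has order n²/α. -/
/-- The permutation of `ZMod n × Fin 3` that translates the three fibres by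
`-s`, `-(k s + w)` and `s + k s + w`. -/
def fibreTranslation (n : ℕ) (k : ZMod n) :
    Multiplicative (ZMod n × ZMod n) →* Equiv.Perm (ZMod n × Fin 3) where
  toFun g :=
    { toFun := fun x => (x.1 - (![g.toAdd.1, k * g.toAdd.1 + g.toAdd.2,
        -(g.toAdd.1 + (k * g.toAdd.1 + g.toAdd.2))] : Fin 3 → ZMod n) x.2, x.2)
      invFun := fun x => (x.1 + (![g.toAdd.1, k * g.toAdd.1 + g.toAdd.2,
        -(g.toAdd.1 + (k * g.toAdd.1 + g.toAdd.2))] : Fin 3 → ZMod n) x.2, x.2)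
      left_inv := fun x => by simp
      right_inv := fun x => by simp }
  map_one' := by
    ext ⟨m, i⟩ <;> fin_cases i <;> simp
  map_mul' g h := by
    ext ⟨m, i⟩ <;> fin_cases i <;> simp <;> ring

theorem fibreTranslation_apply (n : ℕ) (k s w m : ZMod n) (i : Fin 3) :
    fibreTranslation n k (Multiplicative.ofAdd (s, w)) (m, i) =
      (m - (![s, k * s + w, -(s + (k * s + w))] : Fin 3 → ZMod n) i, i) :=
  rfl

theorem fibreTranslation_injective (n : ℕ) (k : ZMod n) :
    Function.Injective (fibreTranslation n k) := by
  rw [injective_iff_map_eq_one]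
  intro g hg
  obtain ⟨⟨s, w⟩, rfl⟩ := Multiplicative.ofAdd.surjective g
  have h0 := congrArg Prod.fst (Equiv.congr_fun hg (0, 0))
  have h1 := congrArg Prod.fst (Equiv.congr_fun hg (0, 1))
  rw [fibreTranslation_apply] at h0 h1
  simp at h0 h1
  subst h0
  simp at h1
  subst h1
  rfl

theorem closure_pair_eq_prod {n : ℕ} (a b c : ZMod n) (u v : ℤ)
    (h : (u : ZMod n) * a + v * b = 1) (k : ZMod n) (hk : k = u * b + v * c) :
    AddSubgroup.closure {((a, b - k * a) : ZMod n × ZMod n), (b, c - k * b)} =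
      (⊤ : AddSubgroup (ZMod n)).prod (AddSubgroup.zmultiples (a * c - b ^ 2)) := by
  apply le_antisymm
  · rw [AddSubgroup.closure_le]
    rintro x (rfl | rfl)
    · refine ⟨trivial, AddSubgroup.mem_zmultiples_iff.2 ⟨-v, ?_⟩⟩
      simp only [zsmul_eq_mul, Int.cast_neg]
      linear_combination b * h + a * hk
    · refine ⟨trivial, AddSubgroup.mem_zmultiples_iff.2 ⟨u, ?_⟩⟩
      simp only [zsmul_eq_mul]
      linear_combination c * h + b * hk
  · rintro ⟨s, w⟩ ⟨-, hw⟩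
    obtain ⟨m, rfl⟩ := AddSubgroup.mem_zmultiples_iff.1 hw
    obtain ⟨s, rfl⟩ := ZMod.intCast_surjective s
    obtain ⟨a', rfl⟩ := ZMod.intCast_surjective a
    obtain ⟨b', rfl⟩ := ZMod.intCast_surjective b
    rw [AddSubgroup.mem_closure_pair]
    refine ⟨s * u - m * b', s * v + m * a', ?_⟩
    ext
    · simp
      linear_combination s * h
    · simp
      linear_combination -s * k * h - s * hk

theorem addOrderOf_intCast {n : ℕ} (hn : n ≠ 0) (d : ℤ) :
    addOrderOf (d : ZMod n) = n / Int.gcd n d := by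
  have hnat : addOrderOf ((d.natAbs : ℕ) : ZMod n) = n / Int.gcd n d :=
    ZMod.addOrderOf_coe _ hn
  rw [← hnat]
  obtain h | h := Int.natAbs_eq d
  · conv_lhs => rw [h, Int.cast_natCast]
  · conv_lhs => rw [h, Int.cast_neg, Int.cast_natCast, addOrderOf_neg]

theorem exists_mul_add_mul_eq_one {p0 p1 p2 : ℕ} (h : Nat.gcd p0 (Nat.gcd p1 p2) = 1) :
    ∃ u v : ℤ, (u : ZMod (p0 + p1 + p2)) * p1 + v * p2 = 1 := by
  have hc : IsCoprime (p0 : ℤ) (Nat.gcd p1 p2 : ℤ) := Nat.isCoprime_iff_coprime.2 h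
  obtain ⟨x, y, hxy⟩ := hc
  rw [Nat.gcd_eq_gcd_ab] at hxy
  have hz : (p0 : ZMod (p0 + p1 + p2)) + p1 + p2 = 0 := by
    exact_mod_cast ZMod.natCast_self (p0 + p1 + p2)
  have hxy' := congrArg (Int.cast : ℤ → ZMod (p0 + p1 + p2)) hxy
  push_cast at hxy'
  refine ⟨y * Nat.gcdA p1 p2 - x, y * Nat.gcdB p1 p2 - x, ?_⟩
  push_cast
  linear_combination hxy' - x * hz

theorem stmt_4 (p0 p1 p2 : ℕ) (hp0 : 0 < p0) (hp1 : 0 < p1) (hp2 : 0 < p2) (hgcd : Nat.gcd p0 (Nat.gcd p1 p2) = 1)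
    (n : ℕ) (hn : n = p0 + p1 + p2)
    (σ0 σ1 : Equiv.Perm (ZMod n × Fin 3))
    (hσ0 : σ0 = sigma0 n) (hσ1 : σ1 = sigma1 p0 p1 p2 n)
    (α : ℕ) (hα : α = Int.gcd (n : ℤ) ((p0 : ℤ) * p1 - (p2 : ℤ) ^ 2))
    (N : Subgroup (Equiv.Perm (ZMod n × Fin 3)))
    (hN : N = Subgroup.closure {σ0 * σ1, σ1 * σ0}) :
    Nat.card N = n ^ 2 / α := by
  have hn0 : n ≠ 0 := by omega
  have hz : (p0 : ZMod n) + p1 + p2 = 0 := by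
    rw [hn]
    exact_mod_cast ZMod.natCast_self (p0 + p1 + p2)
  obtain ⟨u, v, huv⟩ : ∃ u v : ℤ, (u : ZMod n) * p1 + v * p2 = 1 := by
    rw [hn]
    exact exists_mul_add_mul_eq_one hgcd
  set k : ZMod n := u * p2 + v * p0 with hk
  have h01 : σ0 * σ1 =
      fibreTranslation n k (Multiplicative.ofAdd ((p1 : ZMod n), (p2 : ZMod n) - k * p1)) := by
    rw [hσ0, hσ1]
    ext ⟨m, i⟩ : 1
    rw [fibreTranslation_apply]
    fin_cases i <;> simp [sigma0, sigma1, shift]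
    linear_combination hz
  have h10 : σ1 * σ0 =
      fibreTranslation n k (Multiplicative.ofAdd ((p2 : ZMod n), (p0 : ZMod n) - k * p2)) := by
    rw [hσ0, hσ1]
    ext ⟨m, i⟩ : 1
    rw [fibreTranslation_apply]
    fin_cases i <;> simp [sigma0, sigma1, shift]
    linear_combination hz
  have hmap : N = ((⊤ : AddSubgroup (ZMod n)).prod (AddSubgroup.zmultiples
      ((p1 : ZMod n) * p0 - (p2 : ZMod n) ^ 2))).toSubgroup.map (fibreTranslation n k) := by
    rw [← closure_pair_eq_prod _ _ _ u v huv k hk, AddSubgroup.toSubgroup_closure,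
      MonoidHom.map_closure, hN, h01, h10, ← Set.image_pair]
    rfl
  have hd : (p1 : ZMod n) * p0 - (p2 : ZMod n) ^ 2 =
      (((p0 : ℤ) * p1 - (p2 : ℤ) ^ 2 : ℤ) : ZMod n) := by
    push_cast
    ring
  have hcard : Nat.card N = n * (n / α) := by
    rw [hmap, Subgroup.card_map_of_injective (fibreTranslation_injective n k)]
    change Nat.card ((⊤ : AddSubgroup (ZMod n)).prod _) = _
    rw [Nat.card_congr (AddSubgroup.prodEquiv _ _).toEquiv, Nat.card_prod, Nat.card_zmultiples,
      hd, addOrderOf_intCast hn0, AddSubgroup.card_top, Nat.card_zmod, hα]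
  have hdvd : α ∣ n := by
    rw [hα]
    exact_mod_cast Int.gcd_dvd_left (n : ℤ) _
  rw [hcard, sq, Nat.mul_div_assoc _ hdvd]
end

section
/- Let p₀, p₁, p₂ be positive integers with gcd(p₀, p₁, p₂) = 1, let n = p₀ + p₁ + p₂, and let σ₀, σ₁ be the monodromy permutations of the dessin D(p₀, p₁, p₂). Then the subgroups N = ⟨σ₀σ₁, σ₁σ₀⟩ and H = ⟨σ₀⟩ of the permutation group of the edge set intersect trivially: N ∩ H = {id}. -/
/-- If every generator preserves the fibres of `π`, so does every element of the subgroup. -/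
theorem apply_eq_of_mem_closure {X Y : Type*} (π : X → Y) {s : Set (Equiv.Perm X)}
    (hs : ∀ f ∈ s, ∀ x, π (f x) = π x) {f : Equiv.Perm X} (hf : f ∈ Subgroup.closure s) (x : X) :
    π (f x) = π x := by
  induction hf using Subgroup.closure_induction generalizing x with
  | mem f hf => exact hs f hf x
  | one => rfl
  | mul f g _ _ hf hg => rw [Equiv.Perm.mul_apply, hf, hg]
  | inv f _ hf => rw [← hf (f⁻¹ x), ← Equiv.Perm.mul_apply, mul_inv_cancel, Equiv.Perm.one_apply]

theorem stmt_6 (p0 p1 p2 : ℕ) (hp0 : 0 < p0) (hp1 : 0 < p1) (hp2 : 0 < p2) (hgcd : Nat.gcd p0 (Nat.gcd p1 p2) = 1)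
    (n : ℕ) (hn : n = p0 + p1 + p2)
    (σ0 σ1 : Equiv.Perm (ZMod n × Fin 3))
    (hσ0 : σ0 = sigma0 n) (hσ1 : σ1 = sigma1 p0 p1 p2 n)
    (N H : Subgroup (Equiv.Perm (ZMod n × Fin 3)))
    (hN : N = Subgroup.closure {σ0 * σ1, σ1 * σ0})
    (hH : H = Subgroup.closure {σ0}) :
    N ⊓ H = ⊥ := by
  subst hσ0 hσ1 hN hH
  rw [eq_bot_iff]
  rintro f ⟨hfN, hfH⟩
  rw [Subgroup.mem_bot]
  ext1 x
  refine Prod.ext (apply_eq_of_mem_closure Prod.fst ?_ hfH x)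
    (apply_eq_of_mem_closure Prod.snd ?_ hfN x)
  · rintro g rfl y
    rfl
  · rintro g (rfl | rfl) ⟨m, i⟩
    · change i + 2 + 1 = i
      fin_cases i <;> rfl
    · change i + 1 + 2 = i
      fin_cases i <;> rfl
end

section
/- Let p₀, p₁, p₂ be positive integers, let n = p₀ + p₁ + p₂, and let σ₀, σ₁ be the monodromy permutations of the dessin D(p₀, p₁, p₂). Then, with N = ⟨σ₀σ₁, σ₁σ₀⟩, H = ⟨σ₀⟩, and G = ⟨σ₀, σ₁⟩, one has NH = G; that is, every element of G can be written as a product of an element of N and an element of H. -/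
open scoped Pointwise

/-- If `a ^ 3 = b ^ 3 = 1`, then `a` normalizes the subgroup generated by `a * b` and `b * a`. -/
lemma mem_normalizer_closure_mul_mul_of_pow_three_eq_one {K : Type*} [Group K] {a b : K}
    (ha : a ^ 3 = 1) (hb : b ^ 3 = 1) :
    a ∈ Subgroup.normalizer (Subgroup.closure {a * b, b * a} : Set K) := by
  set N := Subgroup.closure {a * b, b * a} with hN
  have hx : a * b ∈ N := Subgroup.subset_closure (by simp)
  have hy : b * a ∈ N := Subgroup.subset_closure (by simp)
  have conj_mem : ∀ g ∈ N, a * g * a⁻¹ ∈ N := by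
    intro g hg
    suffices h : N ≤ N.comap (MulAut.conj a).toMonoidHom from h hg
    rw [hN, Subgroup.closure_le, ← hN]
    rintro z (rfl | rfl)
    · have h : a * (a * b) * a⁻¹ = (a * b * (b * a))⁻¹ := by
        refine eq_inv_of_mul_eq_one_left ?_
        calc a * (a * b) * a⁻¹ * (a * b * (b * a)) = a ^ 2 * b ^ 3 * a := by
              simp [pow_succ, mul_assoc]
          _ = 1 := by rw [hb, mul_one, ← pow_succ, ha]
      change a * (a * b) * a⁻¹ ∈ N
      rw [h]
      exact N.inv_mem (N.mul_mem hx hy)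
    · change a * (b * a) * a⁻¹ ∈ N
      simpa [mul_assoc] using hx
  rw [Subgroup.mem_normalizer_iff]
  refine fun g => ⟨conj_mem g, fun hg => ?_⟩
  have h := conj_mem _ (conj_mem _ hg)
  have e : a * (a * (a * g * a⁻¹) * a⁻¹) * a⁻¹ = a ^ 3 * g * (a ^ 3)⁻¹ := by simp [pow_succ, mul_assoc]
  rwa [e, ha, one_mul, inv_one, mul_one] at h

/-- If `a ^ 3 = b ^ 3 = 1`, then `⟨a * b, b * a⟩ ⟨a⟩ = ⟨a, b⟩`. -/
lemma closure_mul_closure_eq_of_pow_three_eq_one {K : Type*} [Group K] {a b : K}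
    (ha : a ^ 3 = 1) (hb : b ^ 3 = 1) :
    (Subgroup.closure {a * b, b * a} : Set K) * (Subgroup.closure {a} : Set K) =
      (Subgroup.closure {a, b} : Set K) := by
  have hle : Subgroup.closure {a} ≤
      Subgroup.normalizer (Subgroup.closure {a * b, b * a} : Set K) := by
    simpa [Subgroup.closure_le] using mem_normalizer_closure_mul_mul_of_pow_three_eq_one ha hb
  rw [← Subgroup.coe_mul_of_right_le_normalizer_left _ _ hle]
  congr 1
  have ha' : a ∈ Subgroup.closure {a, b} := Subgroup.subset_closure (by simp)
  have hb' : b ∈ Subgroup.closure {a, b} := Subgroup.subset_closure (by simp)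
  apply le_antisymm
  · rw [sup_le_iff, Subgroup.closure_le, Subgroup.closure_le]
    refine ⟨?_, by simpa using ha'⟩
    rintro z (rfl | rfl)
    · exact mul_mem ha' hb'
    · exact mul_mem hb' ha'
  · rw [Subgroup.closure_le]
    have h1 : a ∈ Subgroup.closure {a * b, b * a} ⊔ Subgroup.closure {a} :=
      Subgroup.mem_sup_right (Subgroup.subset_closure rfl)
    have h2 : a * b ∈ Subgroup.closure {a * b, b * a} ⊔ Subgroup.closure {a} :=
      Subgroup.mem_sup_left (Subgroup.subset_closure (by simp))
    rintro z (rfl | rfl)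
    · exact h1
    · exact (Subgroup.mul_mem_cancel_left _ h1).1 h2

lemma sigma0_pow_three (n : ℕ) : sigma0 n ^ 3 = 1 := by
  ext1 ⟨m, i⟩
  fin_cases i <;> simp [pow_succ, sigma0]

lemma sigma1_pow_three (p0 p1 p2 : ℕ) :
    sigma1 p0 p1 p2 (p0 + p1 + p2) ^ 3 = 1 := by
  have h : (p0 : ZMod (p0 + p1 + p2)) + p1 + p2 = 0 := by
    exact_mod_cast ZMod.natCast_self (p0 + p1 + p2)
  ext1 ⟨m, i⟩
  refine Prod.ext ?_ ?_
  · fin_cases i <;> simp [pow_succ, sigma1, shift] <;> linear_combination -h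
  · fin_cases i <;> simp [pow_succ, sigma1]

theorem stmt_7 (p0 p1 p2 : ℕ) (hp0 : 0 < p0) (hp1 : 0 < p1) (hp2 : 0 < p2)
    (n : ℕ) (hn : n = p0 + p1 + p2)
    (σ0 σ1 : Equiv.Perm (ZMod n × Fin 3))
    (hσ0 : σ0 = sigma0 n) (hσ1 : σ1 = sigma1 p0 p1 p2 n)
    (G N H : Subgroup (Equiv.Perm (ZMod n × Fin 3)))
    (hG : G = Subgroup.closure {σ0, σ1})
    (hN : N = Subgroup.closure {σ0 * σ1, σ1 * σ0})
    (hH : H = Subgroup.closure {σ0}) :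
    (N : Set (Equiv.Perm (ZMod n × Fin 3))) * (H : Set (Equiv.Perm (ZMod n × Fin 3))) =
      (G : Set (Equiv.Perm (ZMod n × Fin 3))) := by
  subst hn hσ0 hσ1 hG hN hH
  exact closure_mul_closure_eq_of_pow_three_eq_one (sigma0_pow_three _) (sigma1_pow_three p0 p1 p2)
end

section
/- Let p₀, p₁, p₂ be positive integers, let n = p₀ + p₁ + p₂, and let σ₀, σ₁ be the monodromy permutations of the dessin D(p₀, p₁, p₂). Then the composite (σ₀σ₁)(σ₁σ₀) acts on the edge set by (σ₀σ₁)(σ₁σ₀)(m, 0) = (m + p₀, 0), (σ₀σ₁)(σ₁σ₀)(m, 1) = (m + p₁, 1), and (σ₀σ₁)(σ₁σ₀)(m, 2) = (m + p₂, 2) for all m ∈ ℤ/nℤ. -/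
theorem stmt_9 (p0 p1 p2 : ℕ) (hp0 : 0 < p0) (hp1 : 0 < p1) (hp2 : 0 < p2)
    (n : ℕ) (hn : n = p0 + p1 + p2)
    (σ0 σ1 : Equiv.Perm (ZMod n × Fin 3))
    (hσ0 : σ0 = sigma0 n) (hσ1 : σ1 = sigma1 p0 p1 p2 n) :
    ∀ m : ZMod n,
      ((σ0 * σ1) * (σ1 * σ0)) (m, 0) = (m + (p0 : ZMod n), 0) ∧
      ((σ0 * σ1) * (σ1 * σ0)) (m, 1) = (m + (p1 : ZMod n), 1) ∧
      ((σ0 * σ1) * (σ1 * σ0)) (m, 2) = (m + (p2 : ZMod n), 2) := by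
  have hsum : (p0 : ZMod n) + p1 + p2 = 0 := by
    rw [← Nat.cast_add, ← Nat.cast_add, ← hn, ZMod.natCast_self]
  subst hσ0 hσ1
  intro m
  refine ⟨Prod.ext ?_ ?_, Prod.ext ?_ ?_, Prod.ext ?_ ?_⟩
  · change m - (p2 : ZMod n) - (p1 : ZMod n) = m + p0
    linear_combination -hsum
  · change (0 : Fin 3) + 1 + 2 + 2 + 1 = 0
    decide
  · change m - (p0 : ZMod n) - (p2 : ZMod n) = m + p1
    linear_combination -hsum
  · change (1 : Fin 3) + 1 + 2 + 2 + 1 = 1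
    decide
  · change m - (p1 : ZMod n) - (p0 : ZMod n) = m + p2
    linear_combination -hsum
  · change (2 : Fin 3) + 1 + 2 + 2 + 1 = 2
    decide
end

section
/- Let p₀, p₁, p₂ be positive integers with gcd(p₀, p₁, p₂) = 1 and let n = p₀ + p₁ + p₂. In the ℤ/nℤ-module (ℤ/nℤ)³, let v₁ = −(p₁, p₂, p₀) and v₂ = −(p₂, p₀, p₁) (entries reduced mod n). Then the submodule of (ℤ/nℤ)³ spanned by v₁ and v₂ has cardinality n²/α, where α = gcd(n, p₀p₁ − p₂²) (a gcd of integers, with p₀p₁ − p₂² taken as an integer). -/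
/-- The additive subgroup of `ZMod n` generated by the image of `d` has `n / gcd (n, d)` elements. -/
lemma ZMod.card_zmultiples_intCast {n : ℕ} (hn : n ≠ 0) (d : ℤ) :
    Nat.card (AddSubgroup.zmultiples (d : ZMod n)) = n / Int.gcd n d := by
  rw [Nat.card_zmultiples]
  obtain ⟨m, rfl | rfl⟩ := d.eq_nat_or_neg
  · simp [ZMod.addOrderOf_coe m hn]
  · simp [ZMod.addOrderOf_coe m hn]

/-- If `a + b + c = 0` and `(b, c)` is unimodular, the span of two cyclic shifts of `(a, b, c)` has
a triangular parametrization. -/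
lemma ZMod.card_span_neg_cyclic_pair {n : ℕ} {a b c x y : ZMod n} (hsum : a + b + c = 0)
    (hxy : x * b + y * c = 1) :
    Nat.card (Submodule.span (ZMod n) {-![b, c, a], -![c, a, b]} :
      Submodule (ZMod n) (Fin 3 → ZMod n)) =
      n * Nat.card (AddSubgroup.zmultiples (a * b - c ^ 2)) := by
  set u := x * c + y * a with hu
  let g : ZMod n × AddSubgroup.zmultiples (a * b - c ^ 2) → Fin 3 → ZMod n :=
    fun q => ![q.1, q.1 * u + q.2, -(q.1 + q.1 * u + q.2)]
  have hg : Function.Injective g := by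
    rintro ⟨s, d⟩ ⟨s', d'⟩ h
    have h0 : s = s' := congrFun h 0
    have h1 : s * u + d = s' * u + d' := congrFun h 1
    subst h0
    rw [Subtype.ext (add_left_cancel h1)]
  have hrange : ((Submodule.span (ZMod n) {-![b, c, a], -![c, a, b]} :
      Submodule (ZMod n) (Fin 3 → ZMod n)) : Set (Fin 3 → ZMod n)) = Set.range g := by
    ext z
    rw [SetLike.mem_coe, Submodule.mem_span_pair]
    constructor
    · rintro ⟨r, t, rfl⟩
      obtain ⟨k, hk⟩ := ZMod.intCast_surjective (r * y - t * x)
      refine ⟨(-(r * b + t * c), ⟨k • (a * b - c ^ 2), k, rfl⟩), ?_⟩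
      ext i
      fin_cases i <;> simp [g, hk, hu]
      · ring
      · linear_combination (-(r * c) - t * a) * hxy
      · linear_combination (r * c + t * a) * hxy + (r + t) * hsum
    · rintro ⟨⟨s, d, k, rfl⟩, rfl⟩
      refine ⟨-(s * x - k * c), -(s * y + k * b), ?_⟩
      ext i
      fin_cases i <;> simp [g, hu]
      · linear_combination s * hxy
      · ring
      · linear_combination (-s) * hxy + (s * x - k * c + s * y + k * b) * hsum
  calc _ = Nat.card (Set.range g) := Nat.card_congr (Equiv.setCongr hrange)
    _ = _ := by rw [Nat.card_range_of_injective hg, Nat.card_prod, Nat.card_zmod]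

theorem stmt_12 (p0 p1 p2 : ℕ) (hp0 : 0 < p0) (hp1 : 0 < p1) (hp2 : 0 < p2) (hgcd : Nat.gcd p0 (Nat.gcd p1 p2) = 1)
    (n : ℕ) (hn : n = p0 + p1 + p2)
    (α : ℕ) (hα : α = Int.gcd (n : ℤ) ((p0 : ℤ) * p1 - (p2 : ℤ) ^ 2))
    (v1 v2 : Fin 3 → ZMod n)
    (hv1 : v1 = -![(p1 : ZMod n), (p2 : ZMod n), (p0 : ZMod n)])
    (hv2 : v2 = -![(p2 : ZMod n), (p0 : ZMod n), (p1 : ZMod n)]) :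
    Nat.card (Submodule.span (ZMod n) {v1, v2} : Submodule (ZMod n) (Fin 3 → ZMod n)) =
      n ^ 2 / α := by
  have hsum : (p0 : ZMod n) + p1 + p2 = 0 := by
    have h := congrArg (Nat.cast : ℕ → ZMod n) hn
    push_cast at h
    rw [← h, ZMod.natCast_self]
  have h1 := congrArg (Int.cast : ℤ → ZMod n) (Nat.gcd_eq_gcd_ab p0 (Nat.gcd p1 p2))
  have h2 := congrArg (Int.cast : ℤ → ZMod n) (Nat.gcd_eq_gcd_ab p1 p2)
  rw [hgcd] at h1
  push_cast at h1 h2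
  rw [h2] at h1
  set c : ZMod n := (Nat.gcdA p0 (Nat.gcd p1 p2) : ZMod n)
  set d : ZMod n := (Nat.gcdB p0 (Nat.gcd p1 p2) : ZMod n)
  set e : ZMod n := (Nat.gcdA p1 p2 : ZMod n)
  set f : ZMod n := (Nat.gcdB p1 p2 : ZMod n)
  have hxy : (e * d - c) * (p1 : ZMod n) + (f * d - c) * p2 = 1 := by
    linear_combination (-c) * hsum - h1
  have hcard := ZMod.card_zmultiples_intCast (n := n) (by omega) ((p0 : ℤ) * p1 - (p2 : ℤ) ^ 2)
  push_cast at hcard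
  have hdvd : α ∣ n := by
    rw [hα]
    exact Int.natCast_dvd_natCast.mp (Int.gcd_dvd_left _ _)
  rw [hv1, hv2, ZMod.card_span_neg_cyclic_pair hsum hxy, hcard, ← hα, sq, Nat.mul_div_assoc _ hdvd]
end

section
/- Let p₀, p₁, p₂ be positive integers, let n = p₀ + p₁ + p₂, and let σ₀, σ₁ be the monodromy permutations of the dessin D(p₀, p₁, p₂). Then σ₀ and σ₁ commute if and only if p₀ ≡ p₁ ≡ p₂ (mod n). In particular, if gcd(p₀, p₁, p₂) = 1, then σ₀ and σ₁ commute if and only if p₀ = p₁ = p₂ = 1. -/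
/-- The two rotations commute exactly when the shift does not depend on the side index. -/
theorem sigma0_mul_sigma1_comm_iff (p0 p1 p2 n : ℕ) :
    sigma0 n * sigma1 p0 p1 p2 n = sigma1 p0 p1 p2 n * sigma0 n ↔
      (p0 : ZMod n) = p1 ∧ (p1 : ZMod n) = p2 := by
  constructor
  · intro h
    have h0 := congrArg Prod.fst (Equiv.congr_fun h (0, 0))
    have h2 := congrArg Prod.fst (Equiv.congr_fun h (0, 2))
    simp [sigma0, sigma1, shift] at h0 h2
    exact ⟨h2, h0⟩
  · rintro ⟨h01, h12⟩
    ext ⟨m, i⟩ : 1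
    fin_cases i <;> simp [sigma0, sigma1, shift, h01, h12]

/-- Integers closer together than the modulus are congruent only if they are equal. -/
theorem Int.ModEq.eq_of_abs_sub_lt {a b n : ℤ} (h : a ≡ b [ZMOD n]) (hlt : |b - a| < n) :
    a = b :=
  (sub_eq_zero.mp (Int.eq_zero_of_abs_lt_dvd h.dvd hlt)).symm


theorem stmt_13 (p0 p1 p2 : ℕ) (hp0 : 0 < p0) (hp1 : 0 < p1) (hp2 : 0 < p2)
    (n : ℕ) (hn : n = p0 + p1 + p2)
    (σ0 σ1 : Equiv.Perm (ZMod n × Fin 3))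
    (hσ0 : σ0 = sigma0 n) (hσ1 : σ1 = sigma1 p0 p1 p2 n) :
    (σ0 * σ1 = σ1 * σ0 ↔
        ((p0 : ℤ) ≡ p1 [ZMOD (n : ℤ)] ∧ (p1 : ℤ) ≡ p2 [ZMOD (n : ℤ)])) ∧
      (Nat.gcd p0 (Nat.gcd p1 p2) = 1 →
        (σ0 * σ1 = σ1 * σ0 ↔ (p0 = 1 ∧ p1 = 1 ∧ p2 = 1))) := by
  subst hσ0 hσ1
  have key : sigma0 n * sigma1 p0 p1 p2 n = sigma1 p0 p1 p2 n * sigma0 n ↔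
      ((p0 : ℤ) ≡ p1 [ZMOD (n : ℤ)] ∧ (p1 : ℤ) ≡ p2 [ZMOD (n : ℤ)]) := by
    simp [sigma0_mul_sigma1_comm_iff, ← ZMod.intCast_eq_intCast_iff]
  refine ⟨key, fun hgcd => key.trans ⟨?_, ?_⟩⟩
  · rintro ⟨h01, h12⟩
    have e01 : p0 = p1 := by
      exact_mod_cast h01.eq_of_abs_sub_lt (abs_lt.mpr ⟨by lia, by lia⟩)
    have e12 : p1 = p2 := by
      exact_mod_cast h12.eq_of_abs_sub_lt (abs_lt.mpr ⟨by lia, by lia⟩)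
    subst e01 e12
    simpa using hgcd
  · rintro ⟨rfl, rfl, rfl⟩
    exact ⟨rfl, rfl⟩
end

section
/- Let p₀, p₁, p₂ be positive integers, let n = p₀ + p₁ + p₂, and let σ₀, σ₁ be the monodromy permutations of the dessin D(p₀, p₁, p₂). Then the subgroup N = ⟨σ₀σ₁, σ₁σ₀⟩ of the permutation group of the edge set is abelian. -/
/-- A subgroup generated by two commuting elements is commutative. -/
theorem Subgroup.mul_comm_of_mem_closure_pair {G : Type*} [Group G] {a b : G} (h : Commute a b)
    {x y : G} (hx : x ∈ closure {a, b}) (hy : y ∈ closure {a, b}) : x * y = y * x := by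
  refine Commute.eq (closure_induction₂ (p := fun x y _ _ => Commute x y) ?_
    (fun x _ => Commute.one_left x) (fun x _ => Commute.one_right x)
    (fun _ _ _ _ _ _ h₁ h₂ => h₁.mul_left h₂) (fun _ _ _ _ _ _ h₁ h₂ => h₁.mul_right h₂)
    (fun _ _ _ _ h => h.inv_left) (fun _ _ _ _ h => h.inv_right) hx hy)
  rintro x y (rfl | rfl) (rfl | rfl)
  exacts [Commute.refl _, h, h.symm, Commute.refl _]

/-- Both `σ₀σ₁` and `σ₁σ₀` translate each copy of `ZMod n`, so they commute. -/
theorem commute_sigma0_mul_sigma1 (p0 p1 p2 n : ℕ) :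
    Commute (sigma0 n * sigma1 p0 p1 p2 n) (sigma1 p0 p1 p2 n * sigma0 n) := by
  ext1 ⟨m, i⟩
  fin_cases i <;> simp [sigma0, sigma1, shift, sub_right_comm]

theorem stmt_14 (p0 p1 p2 : ℕ) (hp0 : 0 < p0) (hp1 : 0 < p1) (hp2 : 0 < p2)
    (n : ℕ) (hn : n = p0 + p1 + p2)
    (σ0 σ1 : Equiv.Perm (ZMod n × Fin 3))
    (hσ0 : σ0 = sigma0 n) (hσ1 : σ1 = sigma1 p0 p1 p2 n)
    (N : Subgroup (Equiv.Perm (ZMod n × Fin 3)))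
    (hN : N = Subgroup.closure {σ0 * σ1, σ1 * σ0}) :
    ∀ x ∈ N, ∀ y ∈ N, x * y = y * x := by
  subst hσ0 hσ1 hN
  intro x hx y hy
  exact Subgroup.mul_comm_of_mem_closure_pair (commute_sigma0_mul_sigma1 p0 p1 p2 n) hx hy
end

section
/- Let p₀, p₁, p₂ be positive integers with gcd(p₀, p₁, p₂) = 1, let n = p₀ + p₁ + p₂, and let σ₀, σ₁ be the monodromy permutations of the dessin D(p₀, p₁, p₂). Set α = gcd(n, p₀p₁ − p₂²) (a gcd of integers, with p₀p₁ − p₂² taken as an integer). Then the monodromy group G = ⟨σ₀, σ₁⟩ has order 3n²/α. -/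
/-- The permutation `(m, i) ↦ (m + f i, i + k)` of `R × Fin 3`. -/
def shearRotation {R : Type*} [AddCommGroup R] (f : Fin 3 → R) (k : Fin 3) :
    Equiv.Perm (R × Fin 3) where
  toFun x := (x.1 + f x.2, x.2 + k)
  invFun x := (x.1 - f (x.2 - k), x.2 - k)
  left_inv x := by simp
  right_inv x := by simp

theorem shearRotation_mul {R : Type*} [AddCommGroup R] (f g : Fin 3 → R) (k l : Fin 3) :
    shearRotation f k * shearRotation g l =
      shearRotation (fun i => g i + f (i + l)) (l + k) := by
  ext x <;> simp [shearRotation, add_assoc]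

theorem shearRotation_zero_zero {R : Type*} [AddCommGroup R] :
    shearRotation (0 : Fin 3 → R) 0 = 1 := by
  ext x <;> simp [shearRotation]

theorem shearRotation_inv {R : Type*} [AddCommGroup R] (f : Fin 3 → R) (k : Fin 3) :
    (shearRotation f k)⁻¹ = shearRotation (fun i => -f (i - k)) (-k) := by
  rw [inv_eq_iff_mul_eq_one, shearRotation_mul, ← shearRotation_zero_zero]
  congr 1
  · ext i
    simp [← sub_eq_add_neg]
  · simp

theorem shearRotation_injective {R : Type*} [AddCommGroup R] :
    Function.Injective (fun p : (Fin 3 → R) × Fin 3 => shearRotation p.1 p.2) := by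
  rintro ⟨f, k⟩ ⟨g, l⟩ h
  have key : ∀ i, ((0 : R) + f i, i + k) = (0 + g i, i + l) := fun i =>
    DFunLike.congr_fun h ((0 : R), i)
  simp only [zero_add, Prod.mk.injEq, add_right_inj] at key
  exact Prod.ext (funext fun i => (key i).1) (key 0).2

/-- The subgroup of all `shearRotation f k` with `f` in a rotation-invariant subgroup `N`. -/
def shearRotationSubgroup {R : Type*} [AddCommGroup R] (N : AddSubgroup (Fin 3 → R))
    (hN : ∀ f ∈ N, ∀ k : Fin 3, (fun i => f (i + k)) ∈ N) :
    Subgroup (Equiv.Perm (R × Fin 3)) where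
  carrier := {g | ∃ f ∈ N, ∃ k, shearRotation f k = g}
  one_mem' := ⟨0, N.zero_mem, 0, shearRotation_zero_zero⟩
  mul_mem' := by
    rintro _ _ ⟨f, hf, k, rfl⟩ ⟨g, hg, l, rfl⟩
    exact ⟨_, N.add_mem hg (hN f hf l), _, (shearRotation_mul f g k l).symm⟩
  inv_mem' := by
    rintro _ ⟨f, hf, k, rfl⟩
    refine ⟨_, N.neg_mem (hN f hf (-k)), -k, ?_⟩
    rw [shearRotation_inv]
    simp only [sub_eq_add_neg]
    rfl

theorem card_shearRotationSubgroup {R : Type*} [AddCommGroup R] (N : AddSubgroup (Fin 3 → R))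
    (hN : ∀ f ∈ N, ∀ k : Fin 3, (fun i => f (i + k)) ∈ N) :
    Nat.card (shearRotationSubgroup N hN) = 3 * Nat.card N := by
  have e : N × Fin 3 ≃ shearRotationSubgroup N hN :=
    Equiv.ofBijective (fun p => ⟨shearRotation p.1 p.2, p.1, p.1.2, p.2, rfl⟩) <| by
      constructor
      · rintro ⟨f, k⟩ ⟨g, l⟩ h
        have := @shearRotation_injective R _ (f, k) (g, l) (congrArg Subtype.val h)
        obtain ⟨hfg, hkl⟩ := Prod.mk.inj this
        exact Prod.ext (Subtype.ext hfg) hkl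
      · rintro ⟨_, f, hf, k, rfl⟩
        exact ⟨(⟨f, hf⟩, k), rfl⟩
  rw [← Nat.card_congr e, Nat.card_prod, Nat.card_fin, mul_comm]

/-- The map sending `(x, y)` to `x • s + y • t`, where `t` is the cyclic rotation of `s`. -/
def rotationCombination {R : Type*} [CommRing R] (s : Fin 3 → R) : R × R →+ (Fin 3 → R) where
  toFun p i := p.1 * s i + p.2 * s (i + 1)
  map_zero' := by ext; simp
  map_add' p q := by ext; simp; ring

theorem rotationCombination_range_rotate {R : Type*} [CommRing R] (s : Fin 3 → R)
    (hs : s 0 + s 1 + s 2 = 0) :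
    ∀ f ∈ (rotationCombination s).range, ∀ k : Fin 3,
      (fun i => f (i + k)) ∈ (rotationCombination s).range := by
  rintro _ ⟨⟨x, y⟩, rfl⟩ k
  have h2 : s 2 = -s 0 - s 1 := by linear_combination hs
  fin_cases k
  · exact ⟨(x, y), by ext i; simp⟩
  · refine ⟨(-y, x - y), ?_⟩
    ext i
    fin_cases i <;> simp [rotationCombination, h2] <;> ring
  · refine ⟨(y - x, -x), ?_⟩
    ext i
    fin_cases i <;> simp [rotationCombination, h2] <;> ring

/-- The kernel of `rotationCombination` is the annihilator of a `2 × 2` minor. -/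
theorem card_rotationCombination_ker {R : Type*} [CommRing R] (s : Fin 3 → R)
    (hs : s 0 + s 1 + s 2 = 0) (u v w : R) (huvw : u * s 0 + v * s 1 + w * s 2 = 1) :
    Nat.card (rotationCombination s).ker = Nat.card {x : R // (s 2 * s 0 - s 1 ^ 2) * x = 0} := by
  have h2 : s 2 = -s 0 - s 1 := by linear_combination hs
  have mem_ker : ∀ x y, (x, y) ∈ (rotationCombination s).ker ↔
      x * s 0 + y * s 1 = 0 ∧ x * s 1 + y * s 2 = 0 ∧ x * s 2 + y * s 0 = 0 := by
    intro x y
    simp [AddMonoidHom.mem_ker, rotationCombination, funext_iff, Fin.forall_fin_succ]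
  refine Nat.card_congr (Equiv.ofBijective (fun p => ⟨p.1.1, ?_⟩) ⟨?_, ?_⟩)
  · obtain ⟨h0, h1, -⟩ := (mem_ker p.1.1 p.1.2).1 p.2
    linear_combination s 2 * h0 - s 1 * h1
  · rintro ⟨⟨x, y⟩, hp⟩ ⟨⟨x', y'⟩, hq⟩ h
    obtain rfl : x = x' := congrArg Subtype.val h
    obtain ⟨h0, h1, h3⟩ := (mem_ker _ _).1 hp
    obtain ⟨k0, k1, k3⟩ := (mem_ker _ _).1 hq
    have : y = y' := by
      linear_combination v * (h0 - k0) + w * (h1 - k1) + u * (h3 - k3) - (y - y') * huvw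
    simp [this]
  · rintro ⟨x, hx⟩
    refine ⟨⟨(x, -x * (v * s 0 + w * s 1 + u * s 2)), (mem_ker _ _).2 ⟨?_, ?_, ?_⟩⟩, rfl⟩
    all_goals
      rw [h2] at hx huvw ⊢
    · linear_combination (-x * s 0) * huvw + (w - u) * hx
    · linear_combination (-x * s 1) * huvw + (u - v) * hx
    · linear_combination (-x * (-s 0 - s 1)) * huvw + (v - w) * hx

theorem ZMod.card_annihilator_intCast (n : ℕ) [NeZero n] (d : ℤ) :
    Nat.card {x : ZMod n // (d : ZMod n) * x = 0} = Int.gcd n d := by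
  have h := IsAddCyclic.card_nsmulAddMonoidHom_ker (G := ZMod n) d.natAbs
  rw [Nat.card_zmod] at h
  rw [Int.gcd, Int.natAbs_natCast, ← h]
  refine Nat.card_congr (Equiv.subtypeEquivRight fun x => ?_)
  rw [AddMonoidHom.mem_ker, nsmulAddMonoidHom_apply, nsmul_eq_mul, Nat.cast_natAbs]
  rcases abs_choice d with h | h <;> simp [h]

theorem closure_eq_shearRotationSubgroup (p0 p1 p2 n : ℕ) [NeZero n]
    (hs : shift p0 p1 p2 n 0 + shift p0 p1 p2 n 1 + shift p0 p1 p2 n 2 = 0) :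
    Subgroup.closure {sigma0 n, sigma1 p0 p1 p2 n} =
      shearRotationSubgroup (rotationCombination (shift p0 p1 p2 n)).range
        (rotationCombination_range_rotate _ hs) := by
  set s := shift p0 p1 p2 n with hs_def
  have hσ0 : sigma0 n = shearRotation 0 1 := by
    ext x <;> simp [sigma0, shearRotation]
  have hσ1 : sigma1 p0 p1 p2 n = shearRotation (-s) 2 := by
    ext x <;> simp [sigma1, shearRotation, hs_def, sub_eq_add_neg]
  rw [hσ0, hσ1]
  apply le_antisymm
  · rw [Subgroup.closure_le]
    rintro _ (rfl | rfl)
    · exact ⟨0, zero_mem _, 1, rfl⟩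
    · exact ⟨-s, ⟨(-1, 0), by ext i; simp [rotationCombination, hs_def]⟩, 2, rfl⟩
  · rintro _ ⟨_, ⟨⟨x, y⟩, rfl⟩, k, rfl⟩
    set H := Subgroup.closure {shearRotation 0 1, shearRotation (-s) 2}
    have m0 : shearRotation 0 1 ∈ H := Subgroup.subset_closure (by simp)
    have m1 : shearRotation (-s) 2 ∈ H := Subgroup.subset_closure (by simp)
    have hrot : ∀ k, shearRotation (0 : Fin 3 → ZMod n) k ∈ H := by
      have m2 := H.mul_mem m0 m0
      rw [shearRotation_mul] at m2
      intro k
      fin_cases k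
      · exact shearRotation_zero_zero (R := ZMod n) ▸ H.one_mem
      · exact m0
      · simpa [← Pi.zero_def] using m2
    have hmul : ∀ (f : Fin 3 → ZMod n) (r : ZMod n), shearRotation f 0 ∈ H →
        shearRotation (fun i => r * f i) 0 ∈ H := by
      intro f r hf
      have hpow : ∀ j : ℕ, shearRotation f 0 ^ j = shearRotation (fun i => (j : ZMod n) * f i) 0 := by
        intro j
        induction j with
        | zero => simpa [← Pi.zero_def] using shearRotation_zero_zero.symm
        | succ j ih =>
          rw [pow_succ, ih, shearRotation_mul]
          congr 1
          ext i
          simp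
          ring
      have := H.pow_mem hf r.val
      rwa [hpow, ZMod.natCast_zmod_val] at this
    have t1 : shearRotation s 0 ∈ H := by
      have := H.inv_mem (H.mul_mem m0 m1)
      rw [shearRotation_mul, shearRotation_inv] at this
      simpa using this
    have t2 : shearRotation (fun i => s (i + 1)) 0 ∈ H := by
      have := H.mul_mem (hrot 2) (H.mul_mem t1 m0)
      rw [shearRotation_mul, shearRotation_mul] at this
      simpa using this
    have := H.mul_mem (hrot k) (H.mul_mem (hmul _ y t2) (hmul _ x t1))
    rw [shearRotation_mul, shearRotation_mul] at this
    simpa [rotationCombination] using this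

theorem shift_bezout (p0 p1 p2 n : ℕ) (hgcd : Nat.gcd p0 (Nat.gcd p1 p2) = 1) :
    ∃ u v w : ZMod n, u * shift p0 p1 p2 n 0 + v * shift p0 p1 p2 n 1 +
      w * shift p0 p1 p2 n 2 = 1 := by
  have h1 := congrArg (Int.cast : ℤ → ZMod n) (Nat.gcd_eq_gcd_ab p0 (Nat.gcd p1 p2))
  have h2 := congrArg (Int.cast : ℤ → ZMod n) (Nat.gcd_eq_gcd_ab p1 p2)
  rw [hgcd] at h1
  push_cast at h1 h2
  rw [h2] at h1
  refine ⟨(p1.gcdA p2 : ZMod n) * p0.gcdB (p1.gcd p2), (p1.gcdB p2 : ZMod n) * p0.gcdB (p1.gcd p2),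
    p0.gcdA (p1.gcd p2), ?_⟩
  simp only [shift, Matrix.cons_val]
  linear_combination -h1

theorem stmt_15 (p0 p1 p2 : ℕ) (hp0 : 0 < p0) (hp1 : 0 < p1) (hp2 : 0 < p2) (hgcd : Nat.gcd p0 (Nat.gcd p1 p2) = 1)
    (n : ℕ) (hn : n = p0 + p1 + p2)
    (σ0 σ1 : Equiv.Perm (ZMod n × Fin 3))
    (hσ0 : σ0 = sigma0 n) (hσ1 : σ1 = sigma1 p0 p1 p2 n)
    (α : ℕ) (hα : α = Int.gcd (n : ℤ) ((p0 : ℤ) * p1 - (p2 : ℤ) ^ 2))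
    (G : Subgroup (Equiv.Perm (ZMod n × Fin 3)))
    (hG : G = Subgroup.closure {σ0, σ1}) :
    Nat.card G = 3 * n ^ 2 / α := by
  have : NeZero n := ⟨by omega⟩
  have hs : shift p0 p1 p2 n 0 + shift p0 p1 p2 n 1 + shift p0 p1 p2 n 2 = 0 := by
    have h : ((p0 + p1 + p2 : ℕ) : ZMod n) = 0 := by rw [← hn]; exact ZMod.natCast_self n
    push_cast at h
    simp only [shift, Matrix.cons_val]
    linear_combination h
  obtain ⟨u, v, w, huvw⟩ := shift_bezout p0 p1 p2 n hgcd
  set φ := rotationCombination (shift p0 p1 p2 n)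
  have hker : Nat.card φ.ker = α := by
    rw [card_rotationCombination_ker _ hs u v w huvw, hα, ← ZMod.card_annihilator_intCast]
    simp [shift]
  have hcard := φ.ker.card_mul_index
  rw [AddSubgroup.index_ker, hker, Nat.card_prod, Nat.card_zmod] at hcard
  have hαpos : 0 < α := hker ▸ Nat.card_pos
  rw [hG, hσ0, hσ1, closure_eq_shearRotationSubgroup _ _ _ _ hs, card_shearRotationSubgroup]
  refine (Nat.div_eq_of_eq_mul_right hαpos ?_).symm
  rw [sq, ← hcard]
  ring
end
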